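/- arXiv:2204.13137 — 4 statements merged into one kernel-verified Lean document; each statement's English description precedes it below -/
import Mathlib

section
/- Suppose that for all (t, v, x) ∈ [0,T)×ℝ×ℝ the compatibility condition Ĩ₀(t,x) + Ĩ₁(t,x)·v + Ĩ₂(t,x)·v² = 0 holds, where Ĩ₀ := h'(t) + b₀B + ½σ₀²B² + ∂_tA + μ∂_xA + ½ρ²(∂_xxA + (∂_xA)²), Ĩ₁ := b₁B + σ₀σ₁B² + ∂_tB + μ∂_xB + ½ρ²∂_xxB + ρ²∂_xA·∂_xB, and Ĩ₂ := ½ρ²(∂_xB)² + ½σ₁²B². Then u₁ ≡ 0 and B ≡ 0 on [0,T)×ℝ, and consequently h'(t) + ∂_tA + μ∂_xA + ½ρ²(∂_xxA + (∂_xA)²) = 0 on [0,T)×ℝ. -/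
open Real Set intervalIntegral

/-- The leading coefficient of a real quadratic polynomial function that vanishes identically
is zero. -/
theorem leading_coeff_eq_zero_of_quadratic_eq_zero {a b c : ℝ}
    (hq : ∀ v : ℝ, a + b * v + c * v ^ 2 = 0) : c = 0 := by
  linarith [hq 0, hq 1, hq (-1)]

/-- (Case 2: `h = h(t)`, drift and volatility affine in `v`.) If the
compatibility condition `Ĩ₀ + Ĩ₁v + Ĩ₂v² = 0` holds on `[0,T)×ℝ×ℝ`, then `u₁ ≡ 0` and
`B ≡ 0` on `[0,T)×ℝ`, and consequently
`h' + ∂_tA + μ∂_xA + ½ρ²(∂_xxA + (∂_xA)²) = 0` on `[0,T)×ℝ`. -/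
theorem stmt_11 (T x₀ : ℝ) (hT : 0 < T)
    (μ ρ b₀ b₁ σ₀ σ₁ u₀ u₁ : ℝ → ℝ → ℝ)
    (hρ_pos : ∀ t x, 0 < ρ t x)
    (hμ_cont : Continuous fun q : ℝ × ℝ => μ q.1 q.2)
    (hρ_cont : Continuous fun q : ℝ × ℝ => ρ q.1 q.2)
    (hb₀_cont : Continuous fun q : ℝ × ℝ => b₀ q.1 q.2)
    (hb₁_cont : Continuous fun q : ℝ × ℝ => b₁ q.1 q.2)
    (hσ₀_cont : Continuous fun q : ℝ × ℝ => σ₀ q.1 q.2)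
    (hσ₁_cont : Continuous fun q : ℝ × ℝ => σ₁ q.1 q.2)
    (hu₀_cont : Continuous fun q : ℝ × ℝ => u₀ q.1 q.2)
    (hu₁_cont : Continuous fun q : ℝ × ℝ => u₁ q.1 q.2)
    (h h' : ℝ → ℝ) (hh : ∀ t, HasDerivAt h (h' t) t)
    (A B : ℝ → ℝ → ℝ)
    (hA_def : ∀ t x, A t x = ∫ y in x₀..x, u₀ t y / ρ t y)
    (hB_def : ∀ t x, B t x = ∫ y in x₀..x, u₁ t y / ρ t y)
    (At Ax Axx Bt Bx Bxx : ℝ → ℝ → ℝ)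
    (hAt : ∀ t x, HasDerivAt (fun s => A s x) (At t x) t)
    (hAx : ∀ t x, HasDerivAt (fun y => A t y) (Ax t x) x)
    (hAxx : ∀ t x, HasDerivAt (fun y => Ax t y) (Axx t x) x)
    (hBt : ∀ t x, HasDerivAt (fun s => B s x) (Bt t x) t)
    (hBx : ∀ t x, HasDerivAt (fun y => B t y) (Bx t x) x)
    (hBxx : ∀ t x, HasDerivAt (fun y => Bx t y) (Bxx t x) x)
    -- the compatibility condition Ĩ₀ + Ĩ₁·v + Ĩ₂·v² = 0 on [0,T)×ℝ×ℝ
    (hcompat : ∀ t, 0 ≤ t → t < T → ∀ v x,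
      (h' t + b₀ t x * B t x + 1 / 2 * (σ₀ t x) ^ 2 * (B t x) ^ 2
          + At t x + μ t x * Ax t x + 1 / 2 * (ρ t x) ^ 2 * (Axx t x + (Ax t x) ^ 2))
        + (b₁ t x * B t x + σ₀ t x * σ₁ t x * (B t x) ^ 2 + Bt t x + μ t x * Bx t x
            + 1 / 2 * (ρ t x) ^ 2 * Bxx t x + (ρ t x) ^ 2 * Ax t x * Bx t x) * v
        + (1 / 2 * (ρ t x) ^ 2 * (Bx t x) ^ 2 + 1 / 2 * (σ₁ t x) ^ 2 * (B t x) ^ 2) * v ^ 2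
        = 0) :
    (∀ t, 0 ≤ t → t < T → ∀ x, u₁ t x = 0) ∧
    (∀ t, 0 ≤ t → t < T → ∀ x, B t x = 0) ∧
    (∀ t, 0 ≤ t → t < T → ∀ x,
      h' t + At t x + μ t x * Ax t x
        + 1 / 2 * (ρ t x) ^ 2 * (Axx t x + (Ax t x) ^ 2) = 0) := by
  have hBx_zero : ∀ t, 0 ≤ t → t < T → ∀ x, Bx t x = 0 := by
    intro t ht0 htT x
    have hc := leading_coeff_eq_zero_of_quadratic_eq_zero fun v => hcompat t ht0 htT v x
    have hprod : (ρ t x * Bx t x) ^ 2 = 0 := by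
      nlinarith [sq_nonneg (ρ t x * Bx t x), sq_nonneg (σ₁ t x * B t x)]
    exact (mul_eq_zero.mp (pow_eq_zero_iff two_ne_zero |>.mp hprod)).resolve_left
      (hρ_pos t x).ne'
  have hB_zero : ∀ t, 0 ≤ t → t < T → ∀ x, B t x = 0 := by
    intro t ht0 htT x
    have hconst := is_const_of_deriv_eq_zero (f := fun y => B t y)
      (fun y => (hBx t y).differentiableAt)
      (fun y => (hBx t y).deriv.trans (hBx_zero t ht0 htT y)) x x₀
    have hbase : B t x₀ = 0 := by rw [hB_def, integral_same]
    exact hconst.trans hbase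
  refine ⟨fun t ht0 htT x => ?_, hB_zero, fun t ht0 htT x => ?_⟩
  · have hcont : Continuous fun y => u₁ t y / ρ t y :=
      (hu₁_cont.comp (Continuous.prodMk_right t)).div
        (hρ_cont.comp (Continuous.prodMk_right t)) fun y => (hρ_pos t y).ne'
    have hderiv : HasDerivAt (fun y => B t y) (u₁ t x / ρ t x) x := by
      simp only [hB_def]
      exact hcont.integral_hasStrictDerivAt x₀ x |>.hasDerivAt
    have hquot := (hderiv.unique (hBx t x)).trans (hBx_zero t ht0 htT x)
    exact (div_eq_zero_iff.mp hquot).resolve_right (hρ_pos t x).ne'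
  · have h0 := hcompat t ht0 htT 0 x
    rw [hB_zero t ht0 htT x] at h0
    linarith
end

section
/- For all (t, x) ∈ [0,T)×ℝ, the function f satisfies the identity ρ²·∂_xf = ρ·[∂_tH + μ·∂_xH + ½ρ²·∂_xxH] + [ (∂_xμ·ρ − μ·∂_xρ) − ½ρ²·∂_xxρ − ∂_tρ ]·(H − a). Consequently, if H satisfies ∂_tH + μ∂_xH + ½ρ²∂_xxH = 0 on [0,T)×ℝ and the compatibility condition ∂_tρ − ∂_xμ·ρ + ∂_xρ·μ + ½ρ²·∂_xxρ = 0 holds on [0,T)×ℝ, then ∂_xf ≡ 0, i.e. f(t, x) does not depend on x. -/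
open Real Set intervalIntegral

/-- For
`f(t,x) := (μ/ρ − ½∂_xρ)(H − a) + ½∂_xH·ρ + ∫_{x_a}^x [∂_tH/ρ − (H−a)∂_tρ/ρ²](t,y) dy`,
one has `ρ²∂_xf = ρ[∂_tH + μ∂_xH + ½ρ²∂_xxH] + [(∂_xμ·ρ − μ∂_xρ) − ½ρ²∂_xxρ − ∂_tρ](H − a)`
on `[0,T)×ℝ`; consequently, if `∂_tH + μ∂_xH + ½ρ²∂_xxH = 0` and the compatibility
condition `∂_tρ − ∂_xμ·ρ + ∂_xρ·μ + ½ρ²∂_xxρ = 0` hold on `[0,T)×ℝ`, then `∂_xf ≡ 0`. -/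
theorem stmt_14 (T a x_a : ℝ) (hT : 0 < T)
    (μ ρ H : ℝ → ℝ → ℝ)
    (hρ_pos : ∀ t x, 0 < ρ t x)
    (Ht Hx Hxx ρt ρx ρxx μx : ℝ → ℝ → ℝ)
    (hHt : ∀ t x, HasDerivAt (fun s => H s x) (Ht t x) t)
    (hHx : ∀ t x, HasDerivAt (fun y => H t y) (Hx t x) x)
    (hHxx : ∀ t x, HasDerivAt (fun y => Hx t y) (Hxx t x) x)
    (hρt : ∀ t x, HasDerivAt (fun s => ρ s x) (ρt t x) t)
    (hρx : ∀ t x, HasDerivAt (fun y => ρ t y) (ρx t x) x)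
    (hρxx : ∀ t x, HasDerivAt (fun y => ρx t y) (ρxx t x) x)
    (hμx : ∀ t x, HasDerivAt (fun y => μ t y) (μx t x) x)
    -- continuity of the relevant derivatives (so that the FTC applies)
    (hHt_cont : ∀ t, Continuous (fun y => Ht t y))
    (hρt_cont : ∀ t, Continuous (fun y => ρt t y))
    (f : ℝ → ℝ → ℝ)
    (hf_def : ∀ t x, f t x
      = (μ t x / ρ t x - 1 / 2 * ρx t x) * (H t x - a) + 1 / 2 * Hx t x * ρ t x
        + ∫ y in x_a..x, (Ht t y / ρ t y - (H t y - a) * ρt t y / (ρ t y) ^ 2)) :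
    (∀ t, 0 ≤ t → t < T → ∀ x,
      (ρ t x) ^ 2 * deriv (fun y => f t y) x
        = ρ t x * (Ht t x + μ t x * Hx t x + 1 / 2 * (ρ t x) ^ 2 * Hxx t x)
          + ((μx t x * ρ t x - μ t x * ρx t x) - 1 / 2 * (ρ t x) ^ 2 * ρxx t x - ρt t x)
              * (H t x - a)) ∧
    ((∀ t, 0 ≤ t → t < T → ∀ x,
        Ht t x + μ t x * Hx t x + 1 / 2 * (ρ t x) ^ 2 * Hxx t x = 0) →
      (∀ t, 0 ≤ t → t < T → ∀ x,
        ρt t x - μx t x * ρ t x + ρx t x * μ t x + 1 / 2 * (ρ t x) ^ 2 * ρxx t x = 0) →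
      ∀ t, 0 ≤ t → t < T → ∀ x, deriv (fun y => f t y) x = 0) := by
  have hderiv : ∀ t x, HasDerivAt (fun y => f t y)
      (((μx t x * ρ t x - μ t x * ρx t x) / (ρ t x) ^ 2 - 1 / 2 * ρxx t x) * (H t x - a)
        + (μ t x / ρ t x - 1 / 2 * ρx t x) * Hx t x
        + (1 / 2 * Hxx t x * ρ t x + 1 / 2 * Hx t x * ρx t x)
        + (Ht t x / ρ t x - (H t x - a) * ρt t x / (ρ t x) ^ 2)) x := by
    intro t x
    have hρ_ne : ∀ y, ρ t y ≠ 0 := fun y => (hρ_pos t y).ne'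
    have hρ_cont : Continuous (fun y => ρ t y) :=
      continuous_iff_continuousAt.2 fun y => (hρx t y).continuousAt
    have hH_cont : Continuous (fun y => H t y) :=
      continuous_iff_continuousAt.2 fun y => (hHx t y).continuousAt
    have hcont : Continuous
        (fun y => Ht t y / ρ t y - (H t y - a) * ρt t y / (ρ t y) ^ 2) :=
      ((hHt_cont t).div hρ_cont hρ_ne).sub
        (((hH_cont.sub continuous_const).mul (hρt_cont t)).div (hρ_cont.pow 2)
          fun y => pow_ne_zero 2 (hρ_ne y))
    have hdrift := (((hμx t x).fun_div (hρx t x) (hρ_ne x)).fun_sub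
      ((hρxx t x).const_mul (1 / 2))).fun_mul ((hHx t x).sub_const a)
    have hdiffusion := ((hHxx t x).const_mul (1 / 2)).fun_mul (hρx t x)
    have hintegral := hcont.integral_hasStrictDerivAt x_a x |>.hasDerivAt
    rw [funext (hf_def t)]
    exact (hdrift.fun_add hdiffusion).fun_add hintegral
  have hidentity : ∀ t x, (ρ t x) ^ 2 * deriv (fun y => f t y) x
      = ρ t x * (Ht t x + μ t x * Hx t x + 1 / 2 * (ρ t x) ^ 2 * Hxx t x)
        + ((μx t x * ρ t x - μ t x * ρx t x) - 1 / 2 * (ρ t x) ^ 2 * ρxx t x - ρt t x)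
            * (H t x - a) := by
    intro t x
    have hρ_ne : ρ t x ≠ 0 := (hρ_pos t x).ne'
    rw [(hderiv t x).deriv]
    field_simp
    ring
  refine ⟨fun t _ _ x => hidentity t x, fun hpde hcompat t ht₀ htT x => ?_⟩
  have hzero : (ρ t x) ^ 2 * deriv (fun y => f t y) x = 0 := by
    rw [hidentity t x]
    linear_combination ρ t x * hpde t ht₀ htT x - (H t x - a) * hcompat t ht₀ htT x
  exact (mul_eq_zero.1 hzero).resolve_left (pow_ne_zero 2 (hρ_pos t x).ne')
end

section
/- Suppose in addition that ∂_xf ≡ 0 on [0,T)×ℝ, and set f̂(t) := f(t, x_a). Then the function J(t,x) := ∫_{x_a}^x (H(t,y) − a)/ρ(t,y) dy + ∫_t^T f̂(s) ds satisfies, for all (t,x) ∈ [0,T)×ℝ: ρ(t,x)·∂_xJ(t,x) = H(t,x) − a, and ∂_tJ + μ·∂_xJ + ½ρ²·∂_xxJ = 0. -/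
open Real Set intervalIntegral

/-- Suppose `∂_xf ≡ 0` on `[0,T)×ℝ` and set `f̂(t) := f(t, x_a)`. Then
`J(t,x) := ∫_{x_a}^x (H(t,y) − a)/ρ(t,y) dy + ∫_t^T f̂(s) ds` satisfies
`ρ∂_xJ = H − a` and `∂_tJ + μ∂_xJ + ½ρ²∂_xxJ = 0` on `[0,T)×ℝ`. -/
theorem stmt_15 (T a x_a : ℝ) (hT : 0 < T)
    (μ ρ H : ℝ → ℝ → ℝ)
    (hρ_pos : ∀ t x, 0 < ρ t x)
    (Ht Hx Hxx ρt ρx ρxx μx : ℝ → ℝ → ℝ)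
    (hHt : ∀ t x, HasDerivAt (fun s => H s x) (Ht t x) t)
    (hHx : ∀ t x, HasDerivAt (fun y => H t y) (Hx t x) x)
    (hHxx : ∀ t x, HasDerivAt (fun y => Hx t y) (Hxx t x) x)
    (hρt : ∀ t x, HasDerivAt (fun s => ρ s x) (ρt t x) t)
    (hρx : ∀ t x, HasDerivAt (fun y => ρ t y) (ρx t x) x)
    (hρxx : ∀ t x, HasDerivAt (fun y => ρx t y) (ρxx t x) x)
    (hμx : ∀ t x, HasDerivAt (fun y => μ t y) (μx t x) x)
    (hHt_cont : ∀ t, Continuous (fun y => Ht t y))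
    (hρt_cont : ∀ t, Continuous (fun y => ρt t y))
    (f : ℝ → ℝ → ℝ)
    (hf_def : ∀ t x, f t x
      = (μ t x / ρ t x - 1 / 2 * ρx t x) * (H t x - a) + 1 / 2 * Hx t x * ρ t x
        + ∫ y in x_a..x, (Ht t y / ρ t y - (H t y - a) * ρt t y / (ρ t y) ^ 2))
    -- assume ∂_xf ≡ 0 on [0,T)×ℝ
    (hfx : ∀ t, 0 ≤ t → t < T → ∀ x, deriv (fun y => f t y) x = 0)
    -- f̂ := f(·, x_a) is continuous
    (hfhat_cont : Continuous fun t => f t x_a)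
    -- differentiation under the integral sign is justified
    (hdiff : ∀ t x, 0 ≤ t → t < T →
      HasDerivAt (fun s => ∫ y in x_a..x, (H s y - a) / ρ s y)
        (∫ y in x_a..x, (Ht t y / ρ t y - (H t y - a) * ρt t y / (ρ t y) ^ 2)) t)
    (J : ℝ → ℝ → ℝ)
    (hJ_def : ∀ t x, J t x
      = (∫ y in x_a..x, (H t y - a) / ρ t y) + ∫ s in t..T, f s x_a) :
    ∀ t, 0 ≤ t → t < T → ∀ x,
      ρ t x * deriv (fun y => J t y) x = H t x - a ∧
      deriv (fun s => J s x) t + μ t x * deriv (fun y => J t y) x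
        + 1 / 2 * (ρ t x) ^ 2 * deriv (fun y => deriv (fun y' => J t y') y) x = 0 := by
  intro t ht0 htT x
  have hρ_ne : ∀ y, ρ t y ≠ 0 := fun y => (hρ_pos t y).ne'
  have hH_diff : Differentiable ℝ (fun y => H t y) := fun y => (hHx t y).differentiableAt
  have hρ_diff : Differentiable ℝ (fun y => ρ t y) := fun y => (hρx t y).differentiableAt
  have hHx_diff : Differentiable ℝ (fun y => Hx t y) := fun y => (hHxx t y).differentiableAt
  have hρx_diff : Differentiable ℝ (fun y => ρx t y) := fun y => (hρxx t y).differentiableAt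
  have hμ_diff : Differentiable ℝ (fun y => μ t y) := fun y => (hμx t y).differentiableAt
  have hquot_cont : Continuous (fun y => (H t y - a) / ρ t y) :=
    (hH_diff.continuous.sub continuous_const).div hρ_diff.continuous hρ_ne
  have hint_cont :
      Continuous (fun y => Ht t y / ρ t y - (H t y - a) * ρt t y / (ρ t y) ^ 2) :=
    ((hHt_cont t).div hρ_diff.continuous hρ_ne).sub
      (((hH_diff.continuous.sub continuous_const).mul (hρt_cont t)).div
        (hρ_diff.continuous.pow 2) fun y => pow_ne_zero 2 (hρ_ne y))
  have hint_diff : Differentiable ℝ (fun z =>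
      ∫ y in x_a..z, (Ht t y / ρ t y - (H t y - a) * ρt t y / (ρ t y) ^ 2)) := fun z =>
    (hint_cont.integral_hasStrictDerivAt x_a z).hasDerivAt.differentiableAt
  have hf_diff : Differentiable ℝ (fun y => f t y) := by
    rw [funext (hf_def t)]
    exact ((((hμ_diff.fun_div hρ_diff hρ_ne).fun_sub (hρx_diff.const_mul _)).fun_mul
      (hH_diff.sub_const a)).fun_add ((hHx_diff.const_mul _).fun_mul hρ_diff)).fun_add hint_diff
  have hf_const : f t x = f t x_a := is_const_of_deriv_eq_zero hf_diff (hfx t ht0 htT) x x_a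
  have hJx : ∀ y, deriv (fun z => J t z) y = (H t y - a) / ρ t y := fun y => by
    rw [funext (hJ_def t)]
    exact ((hquot_cont.integral_hasStrictDerivAt x_a y).hasDerivAt.add_const _).deriv
  have hJxx : deriv (fun y => deriv (fun z => J t z) y) x
      = (Hx t x * ρ t x - (H t x - a) * ρx t x) / (ρ t x) ^ 2 := by
    rw [funext hJx]
    exact (((hHx t x).sub_const a).fun_div (hρx t x) (hρ_ne x)).deriv
  have hJt : deriv (fun s => J s x) t
      = (∫ y in x_a..x, (Ht t y / ρ t y - (H t y - a) * ρt t y / (ρ t y) ^ 2)) - f t x_a := by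
    rw [funext fun s => hJ_def s x, sub_eq_add_neg]
    exact ((hdiff t x ht0 htT).fun_add (integral_hasDerivAt_left
      (hfhat_cont.intervalIntegrable t T)
      (hfhat_cont.stronglyMeasurableAtFilter _ _) hfhat_cont.continuousAt)).deriv
  have hρ_ne_x := hρ_ne x
  refine ⟨by rw [hJx]; field_simp, ?_⟩
  rw [hJxx, hJx, hJt, ← hf_const, hf_def]
  field_simp
  ring
end

section
/- Define J̄(t,v,x) := ∫_{g^{-1}(v)}^x (H(t,y) − F(t,v,y))/ρ(t,y) dy and the residual R(t,v,x) := ∂_tJ̄ + b·∂_vJ̄ + μ·∂_xJ̄ + ½σ²·∂_vvJ̄ + ½ρ²·∂_xxJ̄. Then for all (t,v,x) ∈ [0,T)×ℝ², ρ²·∂_xR = (H − F)·[ −∂_tρ + ∂_xμ·ρ − μ·∂_xρ − ½ρ²·∂_xxρ ] − ρ·[ ∂_tF + b·∂_vF + μ·∂_xF + ½σ²·∂_vvF + ½ρ²·∂_xxF ] + ρ·[ ∂_tH + μ·∂_xH + ½ρ²·∂_xxH ]. In particular, if the right-hand side vanishes identically, then ∂_xR ≡ 0, i.e. the residual R(t,v,x)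 does not depend on x. -/
open Real Set intervalIntegral

open scoped ContDiff in
/-- An integral over a compact interval depends smoothly on the parameters of a smooth
integrand. -/
theorem contDiff_intervalIntegral_param {E : Type} [NormedAddCommGroup E] [NormedSpace ℝ E]
    [ProperSpace E] (a b : ℝ) (n : ℕ) :
    ∀ {G : Type} [NormedAddCommGroup G] [NormedSpace ℝ G] {f : E × ℝ → G},
      ContDiff ℝ ∞ f → ContDiff ℝ n fun p => ∫ s in a..b, f (p, s) := by
  induction n with
  | zero =>
    intro G _ _ f hf
    exact contDiff_zero.2 (intervalIntegral.continuous_parametric_intervalIntegral_of_continuous'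
      (f := fun p s => f (p, s)) hf.continuous a b)
  | succ n ih =>
    intro G _ _ f hf
    have hf' : ContDiff ℝ ∞ fun q : E × ℝ =>
        (fderiv ℝ f q).comp (ContinuousLinearMap.inl ℝ E ℝ) :=
      (hf.fderiv_right (m := ∞) le_rfl).clm_comp contDiff_const
    refine contDiff_succ_iff_hasFDerivAt.2 ⟨_, ih hf', fun p => ?_⟩
    obtain ⟨C, hC⟩ := ((isCompact_closedBall p 1).prod (isCompact_uIcc (a := a) (b := b)))
      |>.exists_bound_of_continuousOn hf'.continuous.continuousOn
    refine intervalIntegral.hasFDerivAt_integral_of_dominated_of_fderiv_le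
      (F := fun p s => f (p, s))
      (F' := fun p s => (fderiv ℝ f (p, s)).comp (ContinuousLinearMap.inl ℝ E ℝ))
      (bound := fun _ => C) (Metric.closedBall_mem_nhds p one_pos) ?_ ?_ ?_ ?_ ?_ ?_
    · exact .of_forall fun q =>
        (hf.continuous.comp (Continuous.prodMk_right q)).aestronglyMeasurable
    · exact (hf.continuous.comp (Continuous.prodMk_right p)).intervalIntegrable _ _
    · exact (hf'.continuous.comp (Continuous.prodMk_right p)).aestronglyMeasurable
    · exact .of_forall fun s hs q hq => hC (q, s) ⟨hq, uIoc_subset_uIcc hs⟩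
    · exact intervalIntegrable_const
    · exact .of_forall fun s _ q _ =>
        ((hf.differentiable (by simp)) (q, s)).hasFDerivAt.comp q (hasFDerivAt_prodMk_left q s)

open scoped ContDiff in
/-- Smooth dependence on the parameter of an integral whose endpoints also vary smoothly. -/
theorem contDiff_intervalIntegral_param_endpoints {E : Type} [NormedAddCommGroup E]
    [NormedSpace ℝ E] [ProperSpace E] {f : E × ℝ → ℝ} {α β : E → ℝ}
    (hf : ContDiff ℝ ∞ f) (hα : ContDiff ℝ ∞ α) (hβ : ContDiff ℝ ∞ β) :
    ContDiff ℝ ∞ fun p => ∫ y in α p..β p, f (p, y) := by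
  have h : (fun p => ∫ y in α p..β p, f (p, y)) = fun p =>
      (β p - α p) * ∫ s in (0 : ℝ)..1, f (p, (β p - α p) * s + α p) := by
    funext p
    have := intervalIntegral.mul_integral_comp_mul_add (a := 0) (b := 1)
      (f := fun y => f (p, y)) (β p - α p) (α p)
    rw [this]
    congr 1 <;> ring
  rw [h]
  refine (hβ.sub hα).mul (contDiff_infty.2 fun n => ?_)
  exact contDiff_intervalIntegral_param 0 1 n
    (f := fun q : E × ℝ => f (q.1, (β q.1 - α q.1) * q.2 + α q.1)) (by fun_prop)

open scoped ContDiff in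
theorem deriv_fst_eq_fderiv {u : ℝ → ℝ → ℝ} (hu : ContDiff ℝ ∞ fun q : ℝ × ℝ => u q.1 q.2)
    (s y : ℝ) :
    deriv (fun s => u s y) s = fderiv ℝ (fun q : ℝ × ℝ => u q.1 q.2) (s, y) (1, 0) :=
  (HasFDerivAt.comp_hasDerivAt (f := fun s => (s, y)) s
    ((hu.differentiable (by simp)) (s, y)).hasFDerivAt
    ((hasDerivAt_id s).prodMk (hasDerivAt_const s y))).deriv

open scoped ContDiff in
theorem deriv_snd_eq_fderiv {u : ℝ → ℝ → ℝ} (hu : ContDiff ℝ ∞ fun q : ℝ × ℝ => u q.1 q.2)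
    (s y : ℝ) :
    deriv (fun y => u s y) y = fderiv ℝ (fun q : ℝ × ℝ => u q.1 q.2) (s, y) (0, 1) :=
  (HasFDerivAt.comp_hasDerivAt (f := fun y => (s, y)) y
    ((hu.differentiable (by simp)) (s, y)).hasFDerivAt
    ((hasDerivAt_const y s).prodMk (hasDerivAt_id y))).deriv

open scoped ContDiff in
theorem contDiff_deriv_fst {u : ℝ → ℝ → ℝ} (hu : ContDiff ℝ ∞ fun q : ℝ × ℝ => u q.1 q.2) :
    ContDiff ℝ ∞ fun q : ℝ × ℝ => deriv (fun s => u s q.2) q.1 := by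
  simp only [deriv_fst_eq_fderiv hu]
  exact (hu.fderiv_right (m := ∞) le_rfl).clm_apply contDiff_const

open scoped ContDiff in
theorem contDiff_deriv_snd {u : ℝ → ℝ → ℝ} (hu : ContDiff ℝ ∞ fun q : ℝ × ℝ => u q.1 q.2) :
    ContDiff ℝ ∞ fun q : ℝ × ℝ => deriv (fun y => u q.1 y) q.2 := by
  simp only [deriv_snd_eq_fderiv hu]
  exact (hu.fderiv_right (m := ∞) le_rfl).clm_apply contDiff_const

open scoped ContDiff in
/-- Equality of mixed partial derivatives. -/
theorem deriv_deriv_comm {u : ℝ → ℝ → ℝ} (hu : ContDiff ℝ ∞ fun q : ℝ × ℝ => u q.1 q.2)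
    (s y : ℝ) :
    deriv (fun y => deriv (fun s => u s y) s) y = deriv (fun s => deriv (fun y => u s y) y) s := by
  have hd : Differentiable ℝ (fderiv ℝ fun q : ℝ × ℝ => u q.1 q.2) :=
    (hu.fderiv_right (m := ∞) le_rfl).differentiable (by simp)
  have hsymm : IsSymmSndFDerivAt ℝ (fun q : ℝ × ℝ => u q.1 q.2) (s, y) :=
    (contDiff_infty.1 hu 2).contDiffAt.isSymmSndFDerivAt (by simp)
  rw [deriv_snd_eq_fderiv (u := fun s y => deriv (fun s => u s y) s) (contDiff_deriv_fst hu),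
    deriv_fst_eq_fderiv (u := fun s y => deriv (fun y => u s y) y) (contDiff_deriv_snd hu)]
  simp only [deriv_fst_eq_fderiv hu, deriv_snd_eq_fderiv hu]
  rw [fderiv_clm_apply (hd _) (differentiableAt_const _),
    fderiv_clm_apply (hd _) (differentiableAt_const _)]
  simpa using hsymm.eq (0, 1) (1, 0)

open scoped ContDiff in
theorem deriv_sub_div {h f r : ℝ → ℝ} (hh : ContDiff ℝ ∞ h) (hf : ContDiff ℝ ∞ f)
    (hr : ContDiff ℝ ∞ r) (hr0 : ∀ y, r y ≠ 0) (x : ℝ) :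
    deriv (fun y => (h y - f y) / r y) x
      = ((deriv h x - deriv f x) * r x - (h x - f x) * deriv r x) / r x ^ 2 :=
  (((hh.differentiable (by simp) x).hasDerivAt.sub
    (hf.differentiable (by simp) x).hasDerivAt).div
      (hr.differentiable (by simp) x).hasDerivAt (hr0 x)).deriv

open scoped ContDiff in
theorem deriv_deriv_sub_div {h f r : ℝ → ℝ} (hh : ContDiff ℝ ∞ h) (hf : ContDiff ℝ ∞ f)
    (hr : ContDiff ℝ ∞ r) (hr0 : ∀ y, r y ≠ 0) (x : ℝ) :
    deriv (fun z => deriv (fun y => (h y - f y) / r y) z) x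
      = (((deriv (deriv h) x - deriv (deriv f) x) * r x - (h x - f x) * deriv (deriv r) x)
          * r x
        - ((deriv h x - deriv f x) * r x - (h x - f x) * deriv r x) * (2 * deriv r x))
          / r x ^ 3 := by
  have hd {k : ℝ → ℝ} (hk : ContDiff ℝ ∞ k) : HasDerivAt k (deriv k x) x :=
    (hk.differentiable (by simp) x).hasDerivAt
  have hs {k : ℝ → ℝ} (hk : ContDiff ℝ ∞ k) : ContDiff ℝ ∞ (deriv k) :=
    (contDiff_infty_iff_deriv.1 hk).2
  simp only [deriv_sub_div hh hf hr hr0]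
  have h0 := hr0 x
  refine ((((((hd (hs hh)).sub (hd (hs hf))).mul (hd hr)).sub
    (((hd hh).sub (hd hf)).mul (hd (hs hr)))).div ((hd hr).pow 2)
      (pow_ne_zero 2 h0)).deriv).trans ?_
  simp
  field_simp
  ring

/-- With `J̄(t,v,x) := ∫_{g⁻¹(v)}^x (H(t,y) − F(t,v,y))/ρ(t,y) dy` and the
residual `R := ∂_tJ̄ + b∂_vJ̄ + μ∂_xJ̄ + ½σ²∂_vvJ̄ + ½ρ²∂_xxJ̄` (where `b, σ` depend only
on `(t,v)`), one has, for all `(t,v,x) ∈ [0,T)×ℝ²`: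
`ρ²∂_xR = (H − F)[−∂_tρ + ∂_xμ·ρ − μ∂_xρ − ½ρ²∂_xxρ]
          − ρ[∂_tF + b∂_vF + μ∂_xF + ½σ²∂_vvF + ½ρ²∂_xxF]
          + ρ[∂_tH + μ∂_xH + ½ρ²∂_xxH]`.
In particular, if the right-hand side vanishes identically, then `∂_xR ≡ 0`. -/
theorem stmt_16 (T : ℝ) (hT : 0 < T)
    (b σ : ℝ → ℝ → ℝ)  -- b = b(t,v), σ = σ(t,v), independent of x
    (μ ρ : ℝ → ℝ → ℝ)
    (H : ℝ → ℝ → ℝ) (F : ℝ → ℝ → ℝ → ℝ)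
    (g ginv : ℝ → ℝ)
    (hρ_pos : ∀ t x, 0 < ρ t x)
    (hg_mono : StrictMono g) (hg_bij : Function.Bijective g)
    (hginv_left : Function.LeftInverse ginv g) (hginv_right : Function.RightInverse ginv g)
    -- smoothness of all the data (all relevant derivatives exist and are continuous)
    (hb : ContDiff ℝ (⊤ : ℕ∞) fun q : ℝ × ℝ => b q.1 q.2)
    (hσ : ContDiff ℝ (⊤ : ℕ∞) fun q : ℝ × ℝ => σ q.1 q.2)
    (hμ : ContDiff ℝ (⊤ : ℕ∞) fun q : ℝ × ℝ => μ q.1 q.2)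
    (hρ : ContDiff ℝ (⊤ : ℕ∞) fun q : ℝ × ℝ => ρ q.1 q.2)
    (hH : ContDiff ℝ (⊤ : ℕ∞) fun q : ℝ × ℝ => H q.1 q.2)
    (hF : ContDiff ℝ (⊤ : ℕ∞) fun q : ℝ × ℝ × ℝ => F q.1 q.2.1 q.2.2)
    (hg_smooth : ContDiff ℝ (⊤ : ℕ∞) g) (hginv_smooth : ContDiff ℝ (⊤ : ℕ∞) ginv)
    (Jb : ℝ → ℝ → ℝ → ℝ)
    (hJb : ∀ t v x, Jb t v x = ∫ y in ginv v..x, (H t y - F t v y) / ρ t y)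
    (R : ℝ → ℝ → ℝ → ℝ)
    (hR : ∀ t v x, R t v x
      = deriv (fun s => Jb s v x) t
        + b t v * deriv (fun w => Jb t w x) v
        + μ t x * deriv (fun y => Jb t v y) x
        + 1 / 2 * (σ t v) ^ 2 * deriv (fun w => deriv (fun w' => Jb t w' x) w) v
        + 1 / 2 * (ρ t x) ^ 2 * deriv (fun y => deriv (fun y' => Jb t v y') y) x) :
    (∀ t, 0 ≤ t → t < T → ∀ v x,
      (ρ t x) ^ 2 * deriv (fun y => R t v y) x
        = (H t x - F t v x)
              * (-(deriv (fun s => ρ s x) t)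
                  + deriv (fun y => μ t y) x * ρ t x
                  - μ t x * deriv (fun y => ρ t y) x
                  - 1 / 2 * (ρ t x) ^ 2 * deriv (fun y => deriv (fun y' => ρ t y') y) x)
          - ρ t x * (deriv (fun s => F s v x) t
              + b t v * deriv (fun w => F t w x) v
              + μ t x * deriv (fun y => F t v y) x
              + 1 / 2 * (σ t v) ^ 2 * deriv (fun w => deriv (fun w' => F t w' x) w) v
              + 1 / 2 * (ρ t x) ^ 2 * deriv (fun y => deriv (fun y' => F t v y') y) x)
          + ρ t x * (deriv (fun s => H s x) t
              + μ t x * deriv (fun y => H t y) x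
              + 1 / 2 * (ρ t x) ^ 2 * deriv (fun y => deriv (fun y' => H t y') y) x)) ∧
    ((∀ t, 0 ≤ t → t < T → ∀ v x,
        (H t x - F t v x)
              * (-(deriv (fun s => ρ s x) t)
                  + deriv (fun y => μ t y) x * ρ t x
                  - μ t x * deriv (fun y => ρ t y) x
                  - 1 / 2 * (ρ t x) ^ 2 * deriv (fun y => deriv (fun y' => ρ t y') y) x)
          - ρ t x * (deriv (fun s => F s v x) t
              + b t v * deriv (fun w => F t w x) v
              + μ t x * deriv (fun y => F t v y) x
              + 1 / 2 * (σ t v) ^ 2 * deriv (fun w => deriv (fun w' => F t w' x) w) v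
              + 1 / 2 * (ρ t x) ^ 2 * deriv (fun y => deriv (fun y' => F t v y') y) x)
          + ρ t x * (deriv (fun s => H s x) t
              + μ t x * deriv (fun y => H t y) x
              + 1 / 2 * (ρ t x) ^ 2 * deriv (fun y => deriv (fun y' => H t y') y) x) = 0) →
      ∀ t, 0 ≤ t → t < T → ∀ v x, deriv (fun y => R t v y) x = 0) := by
  have hρ0 : ∀ t x, ρ t x ≠ 0 := fun t x => (hρ_pos t x).ne'
  have hf : ContDiff ℝ (⊤ : ℕ∞) fun q : (ℝ × ℝ × ℝ) × ℝ =>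
      (H q.1.1 q.2 - F q.1.1 q.1.2.1 q.2) / ρ q.1.1 q.2 :=
    ((hH.comp (g := fun q : ℝ × ℝ => H q.1 q.2)
        (f := fun q : (ℝ × ℝ × ℝ) × ℝ => (q.1.1, q.2)) (by fun_prop)).sub
      (hF.comp (g := fun q : ℝ × ℝ × ℝ => F q.1 q.2.1 q.2.2)
        (f := fun q : (ℝ × ℝ × ℝ) × ℝ => (q.1.1, q.1.2.1, q.2)) (by fun_prop))).div
      (hρ.comp (g := fun q : ℝ × ℝ => ρ q.1 q.2)
        (f := fun q : (ℝ × ℝ × ℝ) × ℝ => (q.1.1, q.2)) (by fun_prop))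
      fun q => hρ0 _ _
  have hJ : ContDiff ℝ (⊤ : ℕ∞) fun q : ℝ × ℝ × ℝ => Jb q.1 q.2.1 q.2.2 := by
    simp only [hJb]
    exact contDiff_intervalIntegral_param_endpoints hf (α := fun q => ginv q.2.1)
      (β := fun q => q.2.2) (by fun_prop) (by fun_prop)
  have hJx : ∀ t v x, deriv (fun y => Jb t v y) x = (H t x - F t v x) / ρ t x := by
    intro t v x
    simp only [hJb]
    exact Continuous.deriv_integral (fun y => (H t y - F t v y) / ρ t y)
      (hf.continuous.comp (f := fun y => ((t, v, 0), y)) (by fun_prop)) _ _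
  have key : ∀ t v x, (ρ t x) ^ 2 * deriv (fun y => R t v y) x
        = (H t x - F t v x)
              * (-(deriv (fun s => ρ s x) t)
                  + deriv (fun y => μ t y) x * ρ t x
                  - μ t x * deriv (fun y => ρ t y) x
                  - 1 / 2 * (ρ t x) ^ 2 * deriv (fun y => deriv (fun y' => ρ t y') y) x)
          - ρ t x * (deriv (fun s => F s v x) t
              + b t v * deriv (fun w => F t w x) v
              + μ t x * deriv (fun y => F t v y) x
              + 1 / 2 * (σ t v) ^ 2 * deriv (fun w => deriv (fun w' => F t w' x) w) v
              + 1 / 2 * (ρ t x) ^ 2 * deriv (fun y => deriv (fun y' => F t v y') y) x)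
          + ρ t x * (deriv (fun s => H s x) t
              + μ t x * deriv (fun y => H t y) x
              + 1 / 2 * (ρ t x) ^ 2 * deriv (fun y => deriv (fun y' => H t y') y) x) := by
    intro t v x
    have hJtx : ContDiff ℝ (⊤ : ℕ∞) fun q : ℝ × ℝ => Jb q.1 v q.2 :=
      hJ.comp (f := fun q : ℝ × ℝ => (q.1, v, q.2)) (by fun_prop)
    have hJvx : ContDiff ℝ (⊤ : ℕ∞) fun q : ℝ × ℝ => Jb t q.1 q.2 :=
      hJ.comp (f := fun q : ℝ × ℝ => (t, q.1, q.2)) (by fun_prop)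
    have hJvx' : ContDiff ℝ (⊤ : ℕ∞) fun q : ℝ × ℝ => deriv (fun w => Jb t w q.2) q.1 :=
      contDiff_deriv_fst hJvx
    have hFt : ContDiff ℝ (⊤ : ℕ∞) fun s => F s v x :=
      hF.comp (f := fun s : ℝ => (s, v, x)) (by fun_prop)
    have hFv : ContDiff ℝ (⊤ : ℕ∞) fun w => F t w x :=
      hF.comp (f := fun w : ℝ => (t, w, x)) (by fun_prop)
    have hFx : ContDiff ℝ (⊤ : ℕ∞) fun y => F t v y :=
      hF.comp (f := fun y : ℝ => (t, v, y)) (by fun_prop)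
    have hHt : ContDiff ℝ (⊤ : ℕ∞) fun s => H s x :=
      hH.comp (f := fun s : ℝ => (s, x)) (by fun_prop)
    have hHx : ContDiff ℝ (⊤ : ℕ∞) fun y => H t y :=
      hH.comp (f := fun y : ℝ => (t, y)) (by fun_prop)
    have hρt : ContDiff ℝ (⊤ : ℕ∞) fun s => ρ s x :=
      hρ.comp (f := fun s : ℝ => (s, x)) (by fun_prop)
    have hρx : ContDiff ℝ (⊤ : ℕ∞) fun y => ρ t y :=
      hρ.comp (f := fun y : ℝ => (t, y)) (by fun_prop)
    have hμx : ContDiff ℝ (⊤ : ℕ∞) fun y => μ t y :=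
      hμ.comp (f := fun y : ℝ => (t, y)) (by fun_prop)
    have hfx : ContDiff ℝ (⊤ : ℕ∞) fun y => (H t y - F t v y) / ρ t y :=
      (hHx.sub hFx).div hρx fun y => hρ0 t y
    have hd {k : ℝ → ℝ} (hk : ContDiff ℝ (⊤ : ℕ∞) k) : HasDerivAt k (deriv k x) x :=
      (hk.differentiable (by simp) x).hasDerivAt
    have hT' : deriv (fun y => deriv (fun s => Jb s v y) t) x
        = ((deriv (fun s => H s x) t - deriv (fun s => F s v x) t) * ρ t x
            - (H t x - F t v x) * deriv (fun s => ρ s x) t) / ρ t x ^ 2 := by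
      rw [deriv_deriv_comm (u := fun s y => Jb s v y) hJtx]
      simp only [hJx]
      exact deriv_sub_div hHt hFt hρt (fun s => hρ0 s x) t
    have hV : ∀ w, deriv (fun y => deriv (fun w' => Jb t w' y) w) x
        = deriv (fun w' => (H t x - F t w' x) / ρ t x) w := by
      intro w
      rw [deriv_deriv_comm (u := fun w y => Jb t w y) hJvx]
      simp only [hJx]
    have hV' : deriv (fun y => deriv (fun w' => Jb t w' y) v) x
        = -deriv (fun w => F t w x) v / ρ t x := by
      rw [hV, deriv_sub_div contDiff_const hFv contDiff_const (fun _ => hρ0 t x)]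
      have := hρ0 t x
      simp
      field_simp
    have hVV : deriv (fun y => deriv (fun w => deriv (fun w' => Jb t w' y) w) v) x
        = -deriv (fun w => deriv (fun w' => F t w' x) w) v / ρ t x := by
      rw [deriv_deriv_comm (u := fun w y => deriv (fun w' => Jb t w' y) w) hJvx']
      simp only [hV]
      rw [deriv_deriv_sub_div contDiff_const hFv contDiff_const (fun _ => hρ0 t x)]
      have := hρ0 t x
      simp
      field_simp
    have hfxx : ContDiff ℝ (⊤ : ℕ∞) fun y => deriv (fun y' => (H t y' - F t v y') / ρ t y') y :=
      (contDiff_infty_iff_deriv.1 hfx).2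
    have hsum := (((((hd ((contDiff_deriv_fst (u := fun s y => Jb s v y) hJtx).comp
        (f := fun y : ℝ => (t, y)) (by fun_prop))).add
      ((hd (hJvx'.comp (f := fun y : ℝ => (v, y)) (by fun_prop))).const_mul (b t v))).add
      ((hd hμx).mul (hd hfx))).add
      ((hd ((contDiff_deriv_fst (u := fun w y => deriv (fun w' => Jb t w' y) w) hJvx').comp
        (f := fun y : ℝ => (v, y)) (by fun_prop))).const_mul (1 / 2 * (σ t v) ^ 2))).add
      ((((hd hρx).pow 2).const_mul (1 / 2)).mul (hd hfxx)))
    simp only [hR, hJx]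
    refine (congrArg (ρ t x ^ 2 * ·) hsum.deriv).trans ?_
    simp only [Function.comp_def, hT', hV', hVV]
    rw [deriv_sub_div hHx hFx hρx (hρ0 t), deriv_deriv_sub_div hHx hFx hρx (hρ0 t)]
    have := hρ0 t x
    simp
    field_simp
    ring
  refine ⟨fun t _ _ v x => key t v x, fun h t h0 hT v x => ?_⟩
  have := (key t v x).trans (h t h0 hT v x)
  exact (mul_eq_zero.1 this).resolve_left (pow_ne_zero 2 (hρ0 t x))
end
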